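/- Let n, k, r, m be positive integers with r ≥ 2, n > 36k(2k+1)(k+r)r and C(n,k) − C(n−r+1,k) < m ≤ C(n,k) − C(n−r,k). Suppose 𝓕 ⊆ ([n] choose k) has |𝓕| = m, 𝓕 is extremal (ω(𝓕') ≤ ω(𝓕) for every 𝓕' ⊆ ([n] choose k) with |𝓕'| = m), and 𝓕 contains no full star. Then the set X₀ := {x ∈ [n] : |𝓕(x)| ≥ m/(3kr)} satisfies |X₀| < 12r. -/

import Mathlib

open Finset

/-- `ω(𝓕)`: the sum of `|A ∩ B|` over unordered pairs of distinct members of `𝓕`. -/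
def omegaF (F : Finset (Finset ℕ)) : ℕ :=
  ∑ p ∈ F.sym2.filter (fun p => ¬ p.IsDiag),
    Sym2.lift ⟨fun A B => (A ∩ B).card, fun A B => by simp [Finset.inter_comm]⟩ p

/-- `ω(𝓕, 𝓖)`: the sum of `|A ∩ B|` over all ordered pairs `(A, B) ∈ 𝓕 × 𝓖`. -/
def omegaPair (F G : Finset (Finset ℕ)) : ℕ :=
  ∑ A ∈ F, ∑ B ∈ G, (A ∩ B).card

/-- `ω(F, 𝓕)`: the sum of `|F ∩ A|` over all `A ∈ 𝓕`. -/
def omegaSet (F : Finset ℕ) (G : Finset (Finset ℕ)) : ℕ :=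
  ∑ A ∈ G, (F ∩ A).card

/-- `A` precedes `B` in the lexicographic ordering: `min (A \ B) < min (B \ A)`. -/
def lexLT (A B : Finset ℕ) : Prop :=
  (A \ B).min < (B \ A).min

/-- `L` consists of the first `m` sets of `([n] choose k)` in the lexicographic
ordering: it is an `m`-element subfamily all of whose members lexicographically
precede all non-members. -/
def IsInitSeg (n k m : ℕ) (L : Finset (Finset ℕ)) : Prop :=
  L ⊆ (Finset.Icc 1 n).powersetCard k ∧ L.card = m ∧
    ∀ A ∈ L, ∀ B ∈ (Finset.Icc 1 n).powersetCard k, B ∉ L → lexLT A B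

/-- The `(n,k)`-cascade end of `m` is at most `r`: writing
`C(n,k) - m = C(n-r₁,k) + C(n-r₂,k-1) + ⋯ + C(n-rₛ,k-s+1)` in `k`-cascade form
with `1 ≤ r₁ < ⋯ < rₛ ≤ n-1`, one has `rₛ ≤ r`. -/
def CascadeEndLe (n k m r : ℕ) : Prop :=
  ∃ (s : ℕ) (f : Fin (s + 1) → ℕ),
    s + 1 ≤ k ∧ StrictMono f ∧ 1 ≤ f 0 ∧ f (Fin.last s) ≤ n - 1 ∧
    (∀ i : Fin (s + 1), k - (i : ℕ) ≤ n - f i) ∧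
    f (Fin.last s) ≤ r ∧
    n.choose k - m = ∑ i : Fin (s + 1), (n - f i).choose (k - (i : ℕ))

/-- degree of `x` in `F`. -/
def dg (F : Finset (Finset ℕ)) (x : ℕ) : ℕ := (F.filter (fun A => x ∈ A)).card

lemma card_inter_eq (A T : Finset ℕ) : (A ∩ T).card = ∑ x ∈ T, if x ∈ A then 1 else 0 := by
  rw [Finset.inter_comm, ← Finset.filter_mem_eq_inter, Finset.card_filter]

lemma sum_inter_eq (F : Finset (Finset ℕ)) (T : Finset ℕ) :
    ∑ A ∈ F, (A ∩ T).card = ∑ x ∈ T, dg F x := by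
  simp_rw [card_inter_eq, dg, Finset.card_filter]
  exact Finset.sum_comm

lemma omegaSet_eq (F : Finset (Finset ℕ)) (T : Finset ℕ) :
    omegaSet T F = ∑ x ∈ T, dg F x := by
  rw [← sum_inter_eq, omegaSet]
  exact Finset.sum_congr rfl fun A _ => by rw [Finset.inter_comm]

lemma two_omega (F : Finset (Finset ℕ)) :
    2 * omegaF F + ∑ A ∈ F, A.card = omegaPair F F := by
  induction F using Finset.induction_on with
  | empty => simp [omegaF, omegaPair]
  | insert A F hA ih =>
    have h1 : omegaF (insert A F) = omegaF F + omegaSet A F := by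
      have hset : (insert A F).sym2.filter (fun p => ¬ p.IsDiag)
          = (F.sym2.filter (fun p => ¬ p.IsDiag)) ∪ F.image (fun B => s(A, B)) := by
        ext p
        induction p using Sym2.inductionOn with
        | hf a b =>
          simp only [Finset.mem_filter, Finset.mk_mem_sym2_iff, Finset.mem_insert,
            Finset.mem_union, Finset.mem_image, Sym2.mk_isDiag_iff, Sym2.eq_iff]
          constructor
          · rintro ⟨⟨rfl | ha, rfl | hb⟩, hne⟩
            · exact absurd rfl hne
            · exact Or.inr ⟨b, hb, by simp⟩
            · exact Or.inr ⟨a, ha, by simp⟩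
            · exact Or.inl ⟨⟨ha, hb⟩, hne⟩
          · rintro (⟨⟨ha, hb⟩, hne⟩ | ⟨c, hc, ⟨rfl, rfl⟩ | ⟨rfl, rfl⟩⟩)
            · exact ⟨⟨Or.inr ha, Or.inr hb⟩, hne⟩
            · exact ⟨⟨Or.inl rfl, Or.inr hc⟩, fun h => hA (h ▸ hc)⟩
            · exact ⟨⟨Or.inr hc, Or.inl rfl⟩, fun h => hA (h ▸ hc)⟩
      have hdisj : Disjoint (F.sym2.filter (fun p => ¬ p.IsDiag)) (F.image (fun B => s(A, B))) := by
        rw [Finset.disjoint_right]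
        intro p hp hp'
        obtain ⟨B, hB, rfl⟩ := Finset.mem_image.1 hp
        simp only [Finset.mem_filter, Finset.mk_mem_sym2_iff] at hp'
        exact hA hp'.1.1
      unfold omegaF omegaSet
      rw [hset, Finset.sum_union hdisj, Finset.sum_image]
      · simp
      · intro B _ C _ h
        have h' : B = C ∨ A = C ∧ B = A := by simpa using h
        rcases h' with h' | ⟨h1, h2⟩
        · exact h'
        · rw [h2, h1]
    have h2 : omegaPair (insert A F) (insert A F) = omegaPair F F + 2 * omegaSet A F + A.card := by
      unfold omegaPair omegaSet
      rw [Finset.sum_insert hA, Finset.sum_insert hA]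
      simp_rw [Finset.sum_insert hA]
      rw [Finset.sum_add_distrib]
      have : ∑ B ∈ F, (B ∩ A).card = ∑ B ∈ F, (A ∩ B).card :=
        Finset.sum_congr rfl fun B _ => by rw [Finset.inter_comm]
      rw [this, Finset.inter_self]
      ring
    rw [h1, h2, Finset.sum_insert hA, ← ih]
    ring

lemma omega_insert (F : Finset (Finset ℕ)) (A : Finset ℕ) (hA : A ∉ F) :
    omegaF (insert A F) = omegaF F + omegaSet A F := by
  have h1 := two_omega (insert A F)
  have h0 := two_omega F
  have h2 : omegaPair (insert A F) (insert A F) = omegaPair F F + 2 * omegaSet A F + A.card := by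
    unfold omegaPair omegaSet
    rw [Finset.sum_insert hA, Finset.sum_insert hA]
    simp_rw [Finset.sum_insert hA]
    rw [Finset.sum_add_distrib]
    have : ∑ B ∈ F, (B ∩ A).card = ∑ B ∈ F, (A ∩ B).card :=
      Finset.sum_congr rfl fun B _ => by rw [Finset.inter_comm]
    rw [this, Finset.inter_self]
    ring
  rw [Finset.sum_insert hA] at h1
  omega

lemma omegaPair_eq (F : Finset (Finset ℕ)) (V : Finset ℕ) (hF : ∀ A ∈ F, A ⊆ V) :
    omegaPair F F = ∑ x ∈ V, dg F x ^ 2 := by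
  have : omegaPair F F = ∑ A ∈ F, ∑ x ∈ V, if x ∈ A then dg F x else 0 := by
    unfold omegaPair
    refine Finset.sum_congr rfl fun A hA => ?_
    have h := omegaSet_eq F A
    unfold omegaSet at h
    rw [h, ← Finset.sum_filter, Finset.filter_mem_eq_inter, Finset.inter_eq_right.2 (hF A hA)]
  rw [this, Finset.sum_comm]
  refine Finset.sum_congr rfl fun x _ => ?_
  rw [← Finset.sum_filter, Finset.sum_const, smul_eq_mul, sq]
  rfl

lemma pair_count (n k : ℕ) (x y : ℕ) (hx : x ∈ Finset.Icc 1 n) (hy : y ∈ Finset.Icc 1 n)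
    (hxy : x ≠ y) (F : Finset (Finset ℕ)) (hF : F ⊆ (Finset.Icc 1 n).powersetCard k) :
    (F.filter (fun A => x ∈ A ∧ y ∈ A)).card ≤ (n - 2).choose (k - 2) := by
  have hc : (((Finset.Icc 1 n).erase x).erase y).card = n - 2 := by
    rw [Finset.card_erase_of_mem, Finset.card_erase_of_mem hx]
    · simp; omega
    · exact Finset.mem_erase.2 ⟨hxy.symm, hy⟩
  rw [← hc, ← Finset.card_powersetCard]
  refine Finset.card_le_card_of_injOn (fun A => (A.erase x).erase y) ?_ ?_
  · intro A hA
    simp only [Finset.coe_filter, Set.mem_ofPred_eq] at hA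
    have hA1 := Finset.mem_powersetCard.1 (hF hA.1)
    simp only [Finset.mem_coe, Finset.mem_powersetCard]
    refine ⟨Finset.erase_subset_erase _ (Finset.erase_subset_erase _ hA1.1), ?_⟩
    rw [Finset.card_erase_of_mem, Finset.card_erase_of_mem hA.2.1]
    · omega
    · exact Finset.mem_erase.2 ⟨hxy.symm, hA.2.2⟩
  · intro A hA B hB h
    simp only [Finset.coe_filter, Set.mem_ofPred_eq] at hA hB
    simp only at h
    have hA' : y ∈ A.erase x := Finset.mem_erase.2 ⟨hxy.symm, hA.2.2⟩
    have hB' : y ∈ B.erase x := Finset.mem_erase.2 ⟨hxy.symm, hB.2.2⟩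
    have h2 : A.erase x = B.erase x := by
      rw [← Finset.insert_erase hA', ← Finset.insert_erase hB', h]
    rw [← Finset.insert_erase hA.2.1, ← Finset.insert_erase hB.2.1, h2]

lemma overlap (n k : ℕ) (T : Finset ℕ) (hT : T ⊆ Finset.Icc 1 n)
    (F : Finset (Finset ℕ)) (hF : F ⊆ (Finset.Icc 1 n).powersetCard k) :
    2 * ∑ x ∈ T, dg F x ≤ 2 * F.card + T.card ^ 2 * (n - 2).choose (k - 2) := by
  have h1 : ∑ A ∈ F, (A ∩ T).offDiag.card ≤ T.offDiag.card * (n - 2).choose (k - 2) := by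
    have : ∀ A ∈ F, (A ∩ T).offDiag.card
        = ∑ p ∈ T.offDiag, if (p.1 ∈ A ∧ p.2 ∈ A) then 1 else 0 := by
      intro A _
      rw [← Finset.card_filter]
      congr 1
      ext p
      simp only [Finset.mem_offDiag, Finset.mem_inter, Finset.mem_filter]
      tauto
    rw [Finset.sum_congr rfl this, Finset.sum_comm]
    refine le_trans (Finset.sum_le_card_nsmul _ _ ((n - 2).choose (k - 2)) ?_) (by simp)
    intro p hp
    rw [← Finset.card_filter]
    rw [Finset.mem_offDiag] at hp
    exact pair_count n k p.1 p.2 (hT hp.1) (hT hp.2.1) hp.2.2 F hF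
  have h2 : T.offDiag.card ≤ T.card ^ 2 := by
    rw [Finset.offDiag_card, sq]; omega
  have h3 : 2 * ∑ x ∈ T, dg F x ≤ 2 * F.card + ∑ A ∈ F, (A ∩ T).offDiag.card := by
    rw [← sum_inter_eq, Finset.mul_sum]
    have : 2 * F.card = ∑ A ∈ F, 2 := by simp [mul_comm]
    rw [this, ← Finset.sum_add_distrib]
    refine Finset.sum_le_sum fun A _ => ?_
    rw [Finset.offDiag_card]
    generalize (A ∩ T).card = a
    rcases a with _ | _ | a
    · simp
    · simp
    · have : (a + 1 + 1) * (a + 1 + 1) = a * a + 3 * a + 2 + (a + 1 + 1) := by ring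
      rw [this, Nat.add_sub_cancel]
      nlinarith
  calc _ ≤ _ := h3
    _ ≤ _ := by gcongr; exact h1.trans (by gcongr)

lemma choose_step (n j s : ℕ) (hs : s + 2 ≤ n) :
    (n - 1).choose (j + 1) ≤ (n - 1 - s).choose (j + 1) + s * (n - 2).choose j := by
  induction s with
  | zero => simp
  | succ s ih =>
    have h := ih (by omega)
    have e : n - 1 - s = (n - 1 - (s + 1)) + 1 := by omega
    rw [e, Nat.choose_succ_succ] at h
    have h2 : (n - 1 - (s + 1)).choose j ≤ (n - 2).choose j := Nat.choose_le_choose _ (by omega)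
    rw [Nat.succ_eq_add_one] at *
    nlinarith

lemma choose_low (n j s : ℕ) (hs : s + 2 ≤ n) :
    (n - s).choose (j + 2) + s * (n - 1).choose (j + 1)
      ≤ n.choose (j + 2) + s ^ 2 * (n - 2).choose j := by
  induction s with
  | zero => simp
  | succ s ih =>
    have h := ih (by omega)
    have e : n - s = (n - (s + 1)) + 1 := by omega
    rw [e, Nat.choose_succ_succ] at h
    have h2 := choose_step n j s (by omega)
    have e2 : n - 1 - s = n - (s + 1) := by omega
    rw [e2] at h2
    rw [Nat.succ_eq_add_one] at *
    nlinarith [Nat.zero_le ((n-2).choose j), Nat.zero_le (s * (n-2).choose j)]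

/-- the codegree bound is small compared with `m`. -/
lemma delta_bound (n k r m : ℕ) (hr : 2 ≤ r) (hk : 2 ≤ k)
    (hbig : 36 * k * (2 * k + 1) * (k + r) * r < n)
    (hm1 : n.choose k - (n - r + 1).choose k < m) :
    2 * n * r * (n - 2).choose (k - 2) ≤ 5 * k * m := by
  obtain ⟨j, rfl⟩ : ∃ j, k = j + 2 := ⟨k - 2, by omega⟩
  obtain ⟨s, rfl⟩ : ∃ s, r = s + 1 := ⟨r - 1, by omega⟩
  have hbig' : 720 * ((j + 2) * (s + 1)) ≤ n := by
    have : 5 * 4 ≤ (2 * (j + 2) + 1) * (j + 2 + (s + 1)) := Nat.mul_le_mul (by omega) (by omega)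
    calc _ = 36 * (j + 2) * (5 * 4) * (s + 1) := by ring
      _ ≤ 36 * (j + 2) * ((2 * (j + 2) + 1) * (j + 2 + (s + 1))) * (s + 1) := by gcongr
      _ = 36 * (j + 2) * (2 * (j + 2) + 1) * (j + 2 + (s + 1)) * (s + 1) := by ring
      _ ≤ n := hbig.le
  have hsn : s + 2 ≤ n := by nlinarith
  have h1 := choose_low n j s hsn
  have e : n - (s + 1) + 1 = n - s := by omega
  rw [e] at hm1
  have h2 : s * (n - 1).choose (j + 1) ≤ m + s ^ 2 * (n - 2).choose j := by omega
  have h3 : n * (n - 2).choose j ≤ (j + 2) * (n - 1).choose (j + 1) := by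
    obtain ⟨u, rfl⟩ : ∃ u, n = u + 2 := ⟨n - 2, by omega⟩
    simp only [Nat.add_sub_cancel]
    have e1 : u + 2 - 1 = u + 1 := by omega
    rw [e1]
    have a := Nat.add_one_mul_choose_eq u j
    have b := Nat.choose_succ_succ u j
    rw [Nat.succ_eq_add_one] at *
    nlinarith [Nat.zero_le (u.choose (j+1))]
  have e3 : j + 2 - 2 = j := by omega
  rw [e3]
  set d := (n - 2).choose j
  set c := (n - 1).choose (j + 1)
  -- (j+2) m ≥ s n d - (j+2) s^2 d
  have h4 : s * (n * d) ≤ (j + 2) * m + (j + 2) * s ^ 2 * d := by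
    calc s * (n * d) ≤ s * ((j + 2) * c) := by gcongr
      _ = (j + 2) * (s * c) := by ring
      _ ≤ (j + 2) * (m + s ^ 2 * d) := by gcongr
      _ = _ := by ring
  have h5 : 720 * ((j + 2) * s ^ 2 * d) ≤ s * (n * d) := by
    calc 720 * ((j + 2) * s ^ 2 * d) = s * ((720 * ((j + 2) * s)) * d) := by ring
      _ ≤ s * (n * d) := by
        gcongr
        refine le_trans ?_ hbig'
        gcongr
        omega
  have h6 : n * (s + 1) * d ≤ 2 * (s * (n * d)) := by
    have : (s + 1) ≤ 2 * s := by omega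
    calc n * (s + 1) * d ≤ n * (2 * s) * d := by gcongr
      _ = _ := by ring
  nlinarith

/-- a competitor family. -/
lemma sq_lower (n k r m : ℕ) (hrn : r ≤ n)
    (hm2 : m ≤ n.choose k - (n - r).choose k)
    (F : Finset (Finset ℕ)) (hFsub : F ⊆ (Finset.Icc 1 n).powersetCard k)
    (hFcard : F.card = m)
    (hext : ∀ F' ⊆ (Finset.Icc 1 n).powersetCard k, F'.card = m → omegaF F' ≤ omegaF F) :
    m ^ 2 ≤ r * ∑ x ∈ Finset.Icc 1 n, dg F x ^ 2 := by
  have hcard : m ≤ ((Finset.Icc 1 n).powersetCard k \ (Finset.Icc (r+1) n).powersetCard k).card := by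
    rw [Finset.card_sdiff_of_subset]
    · rw [Finset.card_powersetCard, Finset.card_powersetCard]
      simpa using hm2
    · exact Finset.powersetCard_mono (Finset.Icc_subset_Icc (by omega) le_rfl)
  obtain ⟨L, hL, hLm⟩ := Finset.exists_subset_card_eq hcard
  have hLs : L ⊆ (Finset.Icc 1 n).powersetCard k := hL.trans Finset.sdiff_subset
  have hom := hext L hLs hLm
  have key : ∀ G : Finset (Finset ℕ), G ⊆ (Finset.Icc 1 n).powersetCard k → G.card = m →
      2 * omegaF G + m * k = ∑ x ∈ Finset.Icc 1 n, dg G x ^ 2 := by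
    intro G hG hGm
    rw [← omegaPair_eq G (Finset.Icc 1 n) fun A hA => (Finset.mem_powersetCard.1 (hG hA)).1,
      ← two_omega,
      Finset.sum_const_nat fun A hA => (Finset.mem_powersetCard.1 (hG hA)).2, hGm]
  have h1 := key L hLs hLm
  have h2 := key F hFsub hFcard
  have h3 : m ≤ ∑ x ∈ Finset.Icc 1 r, dg L x := by
    rw [← sum_inter_eq, ← hLm, Finset.card_eq_sum_ones]
    refine Finset.sum_le_sum fun A hA => ?_
    rw [Nat.one_le_iff_ne_zero, Finset.card_ne_zero]
    have hA' := Finset.mem_sdiff.1 (hL hA)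
    rw [Finset.mem_powersetCard, Finset.mem_powersetCard] at hA'
    obtain ⟨⟨ha, hb⟩, hc⟩ := hA'
    by_contra hne
    rw [Finset.not_nonempty_iff_eq_empty] at hne
    refine hc ⟨fun x hx => ?_, hb⟩
    have hx1 := Finset.mem_Icc.1 (ha hx)
    rw [Finset.mem_Icc]
    refine ⟨?_, hx1.2⟩
    by_contra hlt
    have : x ∈ A ∩ Finset.Icc 1 r :=
      Finset.mem_inter.2 ⟨hx, Finset.mem_Icc.2 ⟨hx1.1, by omega⟩⟩
    rw [hne] at this
    simp at this
  have h4 : (∑ x ∈ Finset.Icc 1 r, dg L x) ^ 2 ≤ r * ∑ x ∈ Finset.Icc 1 r, dg L x ^ 2 := by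
    have := sq_sum_le_card_mul_sum_sq (s := Finset.Icc 1 r) (f := dg L)
    simpa using this
  have h5 : ∑ x ∈ Finset.Icc 1 r, dg L x ^ 2 ≤ ∑ x ∈ Finset.Icc 1 n, dg L x ^ 2 :=
    Finset.sum_le_sum_of_subset (Finset.Icc_subset_Icc le_rfl hrn)
  calc m ^ 2 ≤ _ := Nat.pow_le_pow_left h3 2
    _ ≤ _ := h4
    _ ≤ r * ∑ x ∈ Finset.Icc 1 n, dg F x ^ 2 := by
      gcongr r * ?_
      omega

lemma swap_ineq (n k m : ℕ) (hk : 0 < k)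
    (F : Finset (Finset ℕ)) (hFsub : F ⊆ (Finset.Icc 1 n).powersetCard k)
    (hFcard : F.card = m)
    (hext : ∀ F' ⊆ (Finset.Icc 1 n).powersetCard k, F'.card = m → omegaF F' ≤ omegaF F)
    (hnostar : ∀ x ∈ Finset.Icc 1 n,
      F.filter (fun A => x ∈ A) ≠ ((Finset.Icc 1 n).powersetCard k).filter (fun A => x ∈ A))
    (x : ℕ) (hx : x ∈ Finset.Icc 1 n) (A : Finset ℕ) (hA : A ∈ F) :
    dg F x ≤ ∑ y ∈ A, dg F y := by
  obtain ⟨G, hG, hxG, hGF⟩ : ∃ G ∈ (Finset.Icc 1 n).powersetCard k, x ∈ G ∧ G ∉ F := by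
    by_contra hcon
    push Not at hcon
    refine hnostar x hx (Finset.Subset.antisymm (Finset.filter_subset_filter _ hFsub) ?_)
    intro B hB
    rw [Finset.mem_filter] at hB ⊢
    exact ⟨hcon B hB.1 hB.2, hB.2⟩
  have hG' : G ∉ F.erase A := fun h => hGF (Finset.mem_of_mem_erase h)
  have h1 := hext (insert G (F.erase A))
    (Finset.insert_subset hG ((Finset.erase_subset _ _).trans hFsub))
    (by rw [Finset.card_insert_of_notMem hG', Finset.card_erase_add_one hA, hFcard])
  have h2 := omega_insert (F.erase A) A (Finset.notMem_erase _ _)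
  rw [Finset.insert_erase hA] at h2
  rw [omega_insert _ _ hG', h2] at h1
  have h3 : omegaSet G (F.erase A) ≤ omegaSet A (F.erase A) := by omega
  have h4 : omegaSet A F = omegaSet A (F.erase A) + k := by
    unfold omegaSet
    rw [← Finset.sum_erase_add _ _ hA, Finset.inter_self,
      (Finset.mem_powersetCard.1 (hFsub hA)).2]
  have h5 : dg F x ≤ omegaSet G (F.erase A) + 1 := by
    have e : dg (F.erase A) x ≤ omegaSet G (F.erase A) := by
      rw [omegaSet_eq]
      exact Finset.single_le_sum (f := dg (F.erase A)) (fun _ _ => Nat.zero_le _) hxG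
    have e2 : dg F x ≤ dg (F.erase A) x + 1 := by
      unfold dg
      rw [Finset.filter_erase]
      have := Finset.pred_card_le_card_erase (s := F.filter (fun A => x ∈ A)) (a := A)
      omega
    omega
  rw [← omegaSet_eq]
  omega

theorem high_degree_vertices_lt_twelve_r
    (n k r m : ℕ) (hr : 2 ≤ r) (hk : 0 < k) (hn : 0 < n) (hm : 0 < m)
    (hbig : 36 * k * (2 * k + 1) * (k + r) * r < n)
    (hm1 : n.choose k - (n - r + 1).choose k < m)
    (hm2 : m ≤ n.choose k - (n - r).choose k)
    (F : Finset (Finset ℕ)) (hFsub : F ⊆ (Finset.Icc 1 n).powersetCard k)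
    (hFcard : F.card = m)
    (hext : ∀ F' ⊆ (Finset.Icc 1 n).powersetCard k, F'.card = m → omegaF F' ≤ omegaF F)
    (hnostar : ∀ x ∈ Finset.Icc 1 n,
      F.filter (fun A => x ∈ A) ≠ ((Finset.Icc 1 n).powersetCard k).filter (fun A => x ∈ A)) :
    ((Finset.Icc 1 n).filter
      (fun x => (m : ℚ) / (3 * (k : ℚ) * (r : ℚ)) ≤ ((F.filter (fun A => x ∈ A)).card : ℚ))).card
      < 12 * r := by
  -- the case k = 1
  have hk2 : 2 ≤ k := by
    by_contra hlt
    have hk1 : k = 1 := by omega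
    subst hk1
    obtain ⟨A, hA⟩ : F.Nonempty := Finset.card_pos.1 (by omega)
    have hA1 := Finset.mem_powersetCard.1 (hFsub hA)
    obtain ⟨x, rfl⟩ := Finset.card_eq_one.1 hA1.2
    refine hnostar x (hA1.1 (by simp))
      (Finset.Subset.antisymm (Finset.filter_subset_filter _ hFsub) ?_)
    intro B hB
    rw [Finset.mem_filter] at hB ⊢
    refine ⟨?_, hB.2⟩
    obtain ⟨y, rfl⟩ := Finset.card_eq_one.1 (Finset.mem_powersetCard.1 hB.1).2
    have : x = y := by simpa using hB.2
    rwa [← this]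
  have hrn : r ≤ n := by
    refine le_trans ?_ hbig.le
    exact Nat.le_mul_of_pos_left r (by positivity)
  have hdelta := delta_bound n k r m hr hk2 hbig hm1
  have hsq := sq_lower n k r m hrn hm2 F hFsub hFcard hext
  have hswap := swap_ineq n k m hk F hFsub hFcard hext hnostar
  have hover : ∀ T ⊆ Finset.Icc 1 n,
      2 * ∑ x ∈ T, dg F x ≤ 2 * m + T.card ^ 2 * (n - 2).choose (k - 2) := by
    intro T hT
    rw [← hFcard]
    exact overlap n k T hT F hFsub
  have hn1 : 72 * k ^ 3 * r ≤ n := by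
    refine le_trans ?_ hbig.le
    have : k * k ≤ (2 * k + 1) * (k + r) := by nlinarith
    calc 72 * k ^ 3 * r = 36 * k * (2 * k * k) * r := by ring
      _ ≤ 36 * k * ((2 * k + 1) * (k + r)) * r := by gcongr <;> omega
      _ = _ := by ring
  have hn2 : 720 * k * r ≤ n := by
    refine le_trans ?_ hbig.le
    have : 5 * 4 ≤ (2 * k + 1) * (k + r) := Nat.mul_le_mul (by omega) (by omega)
    calc 720 * k * r = 36 * k * (5 * 4) * r := by ring
      _ ≤ 36 * k * ((2 * k + 1) * (k + r)) * r := by gcongr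
      _ = _ := by ring
  set d : ℕ := (n - 2).choose (k - 2) with hd
  set X : Finset ℕ := (Finset.Icc 1 n).filter
      (fun x => (m : ℚ) / (3 * (k : ℚ) * (r : ℚ)) ≤ ((F.filter (fun A => x ∈ A)).card : ℚ)) with hX
  have hkQ : (0 : ℚ) < k := by exact_mod_cast hk
  have hrQ : (0 : ℚ) < r := by exact_mod_cast (by omega : 0 < r)
  have hmQ : (0 : ℚ) < m := by exact_mod_cast hm
  have hXmem : ∀ x, x ∈ X ↔ x ∈ Finset.Icc 1 n ∧ m ≤ 3 * k * r * dg F x := by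
    intro x
    rw [hX, Finset.mem_filter, div_le_iff₀ (by positivity)]
    refine and_congr_right fun _ => ?_
    rw [← Nat.cast_le (α := ℚ)]
    push_cast
    rw [dg, mul_comm]
  have hXsub : X ⊆ Finset.Icc 1 n := Finset.filter_subset _ _
  clear_value X d
  -- d in terms of k^3 r and kr
  have hd1 : 144 * k ^ 2 * r ^ 2 * d ≤ 5 * m := by
    have : k * (144 * k ^ 2 * r ^ 2 * d) ≤ k * (5 * m) := by
      calc k * (144 * k ^ 2 * r ^ 2 * d) = 2 * (72 * k ^ 3 * r) * r * d := by ring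
        _ ≤ 2 * n * r * d := by gcongr
        _ ≤ 5 * k * m := hdelta
        _ = _ := by ring
    exact Nat.le_of_mul_le_mul_left this hk
  have hd2 : 288 * r ^ 2 * d ≤ m := by
    have : (5 * k) * (288 * r ^ 2 * d) ≤ (5 * k) * m := by
      calc (5 * k) * (288 * r ^ 2 * d) = 2 * (720 * k * r) * r * d := by ring
        _ ≤ 2 * n * r * d := by gcongr
        _ ≤ 5 * k * m := hdelta
    exact Nat.le_of_mul_le_mul_left this (by omega)
  -- step 1
  have hX4 : X.card < 4 * k * r := by
    by_contra hge
    push Not at hge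
    obtain ⟨T, hTX, hTc⟩ := Finset.exists_subset_card_eq hge
    have h1 := hover T (hTX.trans hXsub)
    have h2 : (4 * k * r) * m ≤ 3 * k * r * ∑ x ∈ T, dg F x := by
      rw [← hTc, Finset.mul_sum, ← smul_eq_mul]
      exact Finset.card_nsmul_le_sum _ _ _ fun x hx => ((hXmem x).1 (hTX hx)).2
    have h3 : 4 * m ≤ 3 * ∑ x ∈ T, dg F x := by
      have : (k * r) * (4 * m) ≤ (k * r) * (3 * ∑ x ∈ T, dg F x) := by
        calc _ = (4 * k * r) * m := by ring
          _ ≤ _ := h2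
          _ = _ := by ring
      exact Nat.le_of_mul_le_mul_left this (by positivity)
    rw [hTc] at h1
    have h4 : (4 * k * r) ^ 2 * d * 9 ≤ 5 * m := by
      calc _ = 144 * k ^ 2 * r ^ 2 * d := by ring
        _ ≤ _ := hd1
    omega
  -- step 2
  have hXsum : 18 * ∑ x ∈ X, dg F x ≤ 23 * m := by
    have h1 := hover X hXsub
    have h4 : X.card ^ 2 * d * 9 ≤ 5 * m := by
      calc _ ≤ (4 * k * r) ^ 2 * d * 9 := by gcongr
        _ = 144 * k ^ 2 * r ^ 2 * d := by ring
        _ ≤ _ := hd1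
    omega
  -- step 3
  have htot : ∑ x ∈ Finset.Icc 1 n, dg F x = k * m := by
    rw [← sum_inter_eq, Finset.sum_const_nat (m := k), hFcard, mul_comm]
    intro A hA
    have := Finset.mem_powersetCard.1 (hFsub hA)
    rw [Finset.inter_eq_left.2 this.1, this.2]
  obtain ⟨x0, hx0, hx0d⟩ : ∃ x ∈ Finset.Icc 1 n, m ≤ 2 * r * dg F x := by
    by_contra hcon
    push Not at hcon
    have a1 : 2 * r * ∑ x ∈ X, dg F x ^ 2 ≤ m * ∑ x ∈ X, dg F x := by
      rw [Finset.mul_sum, Finset.mul_sum]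
      refine Finset.sum_le_sum fun x hx => ?_
      have := hcon x (hXsub hx)
      calc 2 * r * dg F x ^ 2 = (2 * r * dg F x) * dg F x := by ring
        _ ≤ m * dg F x := by gcongr
    have a2 : 3 * k * r * ∑ x ∈ Finset.Icc 1 n \ X, dg F x ^ 2 ≤ m * (k * m) := by
      rw [← htot]
      refine le_trans ?_ (Nat.mul_le_mul_left m
        (Finset.sum_le_sum_of_subset (f := dg F) (Finset.sdiff_subset (s := Finset.Icc 1 n) (t := X))))
      rw [Finset.mul_sum, Finset.mul_sum]
      refine Finset.sum_le_sum fun x hx => ?_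
      rw [Finset.mem_sdiff, hXmem] at hx
      have : 3 * k * r * dg F x ≤ m := by
        by_contra h
        exact hx.2 ⟨hx.1, by omega⟩
      calc 3 * k * r * dg F x ^ 2 = (3 * k * r * dg F x) * dg F x := by ring
        _ ≤ m * dg F x := by gcongr
    have a3 : 3 * (r * ∑ x ∈ Finset.Icc 1 n \ X, dg F x ^ 2) ≤ m ^ 2 := by
      refine le_of_mul_le_mul_left (a := k) ?_ hk
      calc _ = 3 * k * r * ∑ x ∈ Finset.Icc 1 n \ X, dg F x ^ 2 := by ring
        _ ≤ _ := a2
        _ = _ := by ring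
    have a4 : 36 * (r * ∑ x ∈ X, dg F x ^ 2) ≤ 23 * m ^ 2 := by
      calc _ = 18 * (2 * r * ∑ x ∈ X, dg F x ^ 2) := by ring
        _ ≤ 18 * (m * ∑ x ∈ X, dg F x) := by gcongr
        _ = m * (18 * ∑ x ∈ X, dg F x) := by ring
        _ ≤ m * (23 * m) := by gcongr
        _ = _ := by ring
    rw [← Finset.sum_sdiff hXsub, mul_add] at hsq
    have : 0 < m ^ 2 := by positivity
    omega
  -- step 4
  have hdeg : ∀ z ∈ X, m ≤ 6 * r * dg F z := by
    intro z hz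
    have hz1 := (hXmem z).1 hz
    obtain ⟨A, hA, hzA, hAX⟩ : ∃ A ∈ F, z ∈ A ∧ ∀ y ∈ A, y ∈ X → y = z := by
      by_contra hcon
      push Not at hcon
      have b1 : dg F z ≤ X.card * d := by
        have : F.filter (fun A => z ∈ A) ⊆
            (X.erase z).biUnion (fun y => F.filter (fun A => z ∈ A ∧ y ∈ A)) := by
          intro A hA
          rw [Finset.mem_filter] at hA
          obtain ⟨y, hyA, hyX, hyz⟩ := hcon A hA.1 hA.2
          rw [Finset.mem_biUnion]
          exact ⟨y, Finset.mem_erase.2 ⟨hyz, hyX⟩, Finset.mem_filter.2 ⟨hA.1, hA.2, hyA⟩⟩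
        refine (Finset.card_le_card this).trans ?_
        refine (Finset.card_biUnion_le_card_mul _ _ d ?_).trans
          (Nat.mul_le_mul_right _ (Finset.card_le_card (Finset.erase_subset _ _)))
        intro y hy
        rw [Finset.mem_erase] at hy
        rw [hd]
        exact pair_count n k z y hz1.1 (hXsub hy.2) (Ne.symm hy.1) F hFsub
      have b2 : 12 * m ≤ 5 * m := by
        calc 12 * m ≤ 12 * (3 * k * r * dg F z) := by gcongr; exact hz1.2
          _ ≤ 12 * (3 * k * r * (4 * k * r * d)) := by
            gcongr
            exact b1.trans (by gcongr)
          _ = 144 * k ^ 2 * r ^ 2 * d := by ring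
          _ ≤ _ := hd1
      omega
    have c1 := hswap x0 hx0 A hA
    have c2 : 3 * k * r * ∑ y ∈ A.erase z, dg F y ≤ k * m := by
      have hAm := Finset.mem_powersetCard.1 (hFsub hA)
      have : (A.erase z).card ≤ k := hAm.2 ▸ Finset.card_le_card (Finset.erase_subset _ _)
      rw [Finset.mul_sum]
      refine (Finset.sum_le_card_nsmul _ _ m ?_).trans (by rw [smul_eq_mul]; gcongr)
      intro y hy
      rw [Finset.mem_erase] at hy
      by_contra h
      exact hy.1 (hAX y hy.2 ((hXmem y).2 ⟨hAm.1 hy.2, by omega⟩))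
    have c3 : 3 * (r * ∑ y ∈ A.erase z, dg F y) ≤ m := by
      refine le_of_mul_le_mul_left (a := k) ?_ hk
      calc _ = 3 * k * r * ∑ y ∈ A.erase z, dg F y := by ring
        _ ≤ _ := c2
    rw [← Finset.sum_erase_add _ _ hzA] at c1
    have c4 : r * dg F x0 ≤ r * ∑ y ∈ A.erase z, dg F y + r * dg F z := by
      rw [← mul_add]; gcongr
    rw [mul_assoc] at hx0d ⊢
    omega
  -- step 5
  by_contra hge
  push Not at hge
  obtain ⟨T, hTX, hTc⟩ := Finset.exists_subset_card_eq hge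
  have h1 := hover T (hTX.trans hXsub)
  have h2 : (12 * r) * m ≤ 6 * r * ∑ x ∈ T, dg F x := by
    rw [← hTc, Finset.mul_sum, ← smul_eq_mul]
    exact Finset.card_nsmul_le_sum _ _ _ fun x hx => hdeg x (hTX hx)
  have h3 : 2 * m ≤ ∑ x ∈ T, dg F x := by
    refine le_of_mul_le_mul_left (a := 6 * r) ?_ (by omega)
    calc _ = (12 * r) * m := by ring
      _ ≤ _ := h2
  rw [hTc] at h1
  have h4 : (12 * r) ^ 2 * d * 2 ≤ m := by
    calc _ = 288 * r ^ 2 * d := by ring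
      _ ≤ _ := hd2
  omega
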